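/- The radial degree-one Ginzburg–Landau profile: there exists a function f : [0,∞) → [0,1) solving −f'' − f'/r + f/r² = f(1 − f²) for r > 0, with f(0) = 0, f increasing, and f(r) → 1 as r → ∞; moreover 1 − f(r)² ≤ C/r² for r ≥ 1 and some constant C. -/

import Mathlib

open Filter Set

namespace GinzburgLandau

open MeasureTheory Topology

section Improper

variable {f : ℝ → ℝ}

theorem continuous_integral_Iic (hf : ∀ s, IntegrableOn f (Iic s)) :
    Continuous fun s => ∫ x in Iic s, f x := by
  have key : (fun s => ∫ x in Iic s, f x) =
      fun s => (∫ x in Iic 0, f x) + ∫ x in (0 : ℝ)..s, f x := by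
    ext s
    rw [← intervalIntegral.integral_Iic_sub_Iic (hf 0) (hf s)]
    ring
  rw [key]
  refine continuous_const.add (intervalIntegral.continuous_primitive (fun a b => ?_) 0)
  exact ⟨(hf b).mono_set Ioc_subset_Iic_self, (hf a).mono_set Ioc_subset_Iic_self⟩

theorem hasDerivAt_integral_Iic (hf : ∀ s, IntegrableOn f (Iic s)) (hc : Continuous f) (s : ℝ) :
    HasDerivAt (fun s => ∫ x in Iic s, f x) (f s) s := by
  have key : (fun s => ∫ x in Iic s, f x) =
      fun s => (∫ x in Iic 0, f x) + ∫ x in (0 : ℝ)..s, f x := by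
    ext s
    rw [← intervalIntegral.integral_Iic_sub_Iic (hf 0) (hf s)]
    ring
  rw [key]
  exact (hc.integral_hasStrictDerivAt 0 s).hasDerivAt.const_add _

theorem hasDerivAt_integral_Ioi (hf : ∀ s, IntegrableOn f (Ioi s)) (hc : Continuous f) (s : ℝ) :
    HasDerivAt (fun s => ∫ x in Ioi s, f x) (-f s) s := by
  have key : (fun s => ∫ x in Ioi s, f x) =
      fun s => (∫ x in Ioi 0, f x) - ∫ x in (0 : ℝ)..s, f x := by
    ext s
    rw [← intervalIntegral.integral_interval_add_Ioi (hf 0) (hf s)]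
    ring
  rw [key]
  exact (hc.integral_hasStrictDerivAt 0 s).hasDerivAt.const_sub _

theorem integrableOn_Iic_deriv_of_nonneg {g : ℝ → ℝ} (hd : ∀ t, HasDerivAt g (f t) t)
    (hc : Continuous f) (h0 : ∀ t, 0 ≤ f t) {l : ℝ} (hl : Tendsto g atBot (𝓝 l)) (s : ℝ) :
    IntegrableOn f (Iic s) := by
  refine integrableOn_Iic_of_intervalIntegral_norm_tendsto (g s - l) s
    (fun i : ℝ => hc.integrableOn_Ioc) tendsto_id ?_
  have : ∀ a : ℝ, ∫ x in a..s, ‖f x‖ = g s - g a := by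
    intro a
    simp_rw [Real.norm_of_nonneg (h0 _)]
    exact intervalIntegral.integral_eq_sub_of_hasDerivAt (fun x _ => hd x)
      (hc.intervalIntegrable _ _)
  simp only [id, this]
  exact hl.const_sub _

end Improper

/-- The square of the radius, in the logarithmic variable `t = log r`. -/
noncomputable def radSq (t : ℝ) : ℝ := Real.exp (2 * t)

/-- A positive solution of `φ'' = (1 + 4 * radSq + radSq ^ 2) * φ`. -/
noncomputable def weight (t : ℝ) : ℝ := Real.exp (t + radSq t / 2)

/-- The nonlinearity, shifted so as to be monotone in `y ∈ [0, 1]`. -/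
noncomputable def source (t y : ℝ) : ℝ := radSq t * (5 * y - y ^ 3) + radSq t ^ 2 * y

/-- The inner integral of the solution operator. -/
noncomputable def innerInt (g : ℝ → ℝ) (s : ℝ) : ℝ :=
  ∫ τ in Iic s, weight τ * source τ (g τ)

/-- The bounded solution `u` of `u'' - (1 + 4 * radSq + radSq ^ 2) * u = -source t (g t)`. -/
noncomputable def solOp (g : ℝ → ℝ) (t : ℝ) : ℝ :=
  weight t * ∫ s in Ioi t, innerInt g s / weight s ^ 2

theorem radSq_pos (t : ℝ) : 0 < radSq t := Real.exp_pos _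

theorem weight_pos (t : ℝ) : 0 < weight t := Real.exp_pos _

theorem radSq_mono : Monotone radSq := fun a b h => Real.exp_le_exp.2 (by linarith)

theorem hasDerivAt_radSq (t : ℝ) : HasDerivAt radSq (2 * radSq t) t := by
  have := ((hasDerivAt_id t).const_mul 2).exp
  refine this.congr_deriv ?_
  simp [radSq, mul_comm]

theorem hasDerivAt_weight (t : ℝ) : HasDerivAt weight ((1 + radSq t) * weight t) t := by
  have := ((hasDerivAt_id t).add ((hasDerivAt_radSq t).div_const 2)).exp
  refine this.congr_deriv ?_
  simp only [weight, id, Pi.add_apply]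
  ring

theorem hasDerivAt_weight' (t : ℝ) :
    HasDerivAt (fun t => (1 + radSq t) * weight t)
      ((1 + 4 * radSq t + radSq t ^ 2) * weight t) t := by
  refine (((hasDerivAt_radSq t).const_add 1).mul (hasDerivAt_weight t)).congr_deriv ?_
  ring

@[fun_prop]
theorem continuous_radSq : Continuous radSq := by unfold radSq; fun_prop

@[fun_prop]
theorem continuous_weight : Continuous weight := by unfold weight; fun_prop

theorem tendsto_radSq_atBot : Tendsto radSq atBot (𝓝 0) :=
  Real.tendsto_exp_atBot.comp (tendsto_id.const_mul_atBot (by norm_num : (0 : ℝ) < 2))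

theorem tendsto_weight_atBot : Tendsto weight atBot (𝓝 0) :=
  Real.tendsto_exp_atBot.comp
    (tendsto_id.atBot_add (tendsto_radSq_atBot.div_const 2))

theorem tendsto_weight'_atBot : Tendsto (fun t => (1 + radSq t) * weight t) atBot (𝓝 0) := by
  simpa using (tendsto_radSq_atBot.const_add 1).mul tendsto_weight_atBot

theorem tendsto_weight_inv_atTop : Tendsto (fun t => (weight t)⁻¹) atTop (𝓝 0) := by
  refine tendsto_inv_atTop_zero.comp (tendsto_atTop_mono (fun t => ?_) Real.tendsto_exp_atTop)
  exact Real.exp_le_exp.2 (by linarith [radSq_pos t])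

theorem source_mono (t : ℝ) {x y : ℝ} (hx : 0 ≤ x) (hxy : x ≤ y) (hy : y ≤ 1) :
    source t x ≤ source t y := by
  have h1 : 5 * x - x ^ 3 ≤ 5 * y - y ^ 3 := by
    nlinarith [mul_nonneg hx (sub_nonneg.2 hxy), sq_nonneg (x + y), sq_nonneg (x - y),
      mul_nonneg (sub_nonneg.2 hxy) (by nlinarith : 0 ≤ 5 - (x ^ 2 + x * y + y ^ 2))]
  unfold source
  have := radSq_pos t
  gcongr

theorem source_nonneg (t : ℝ) {y : ℝ} (h0 : 0 ≤ y) (h1 : y ≤ 1) : 0 ≤ source t y := by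
  simpa [source] using source_mono t le_rfl h0 h1

theorem source_le (t : ℝ) {y : ℝ} (h0 : 0 ≤ y) (h1 : y ≤ 1) :
    source t y ≤ 1 + 4 * radSq t + radSq t ^ 2 := by
  have := source_mono t h0 h1 le_rfl
  unfold source at *
  linarith

variable {g h : ℝ → ℝ}

theorem measurable_weight_source (hm : Measurable g) :
    Measurable fun τ => weight τ * source τ (g τ) := by
  have := continuous_weight.measurable
  have := continuous_radSq.measurable
  unfold source
  fun_prop

theorem integrableOn_weight'' (s : ℝ) :
    IntegrableOn (fun t => (1 + 4 * radSq t + radSq t ^ 2) * weight t) (Iic s) :=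
  integrableOn_Iic_deriv_of_nonneg hasDerivAt_weight' (by fun_prop)
    (fun t => by have := radSq_pos t; have := weight_pos t; positivity) tendsto_weight'_atBot s

theorem weight_source_nonneg (hg : ∀ t, g t ∈ Icc 0 1) (t : ℝ) :
    0 ≤ weight t * source t (g t) :=
  mul_nonneg (weight_pos t).le (source_nonneg t (hg t).1 (hg t).2)

theorem weight_source_le (hg : ∀ t, g t ∈ Icc 0 1) (t : ℝ) :
    weight t * source t (g t) ≤ (1 + 4 * radSq t + radSq t ^ 2) * weight t := by
  rw [mul_comm]
  exact mul_le_mul_of_nonneg_right (source_le t (hg t).1 (hg t).2) (weight_pos t).le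

theorem integrableOn_weight_source (hm : Measurable g) (hg : ∀ t, g t ∈ Icc 0 1) (s : ℝ) :
    IntegrableOn (fun τ => weight τ * source τ (g τ)) (Iic s) := by
  refine (integrableOn_weight'' s).mono' (measurable_weight_source hm).aestronglyMeasurable ?_
  refine Eventually.of_forall fun t => ?_
  rw [Real.norm_of_nonneg (weight_source_nonneg hg t)]
  exact weight_source_le hg t

theorem innerInt_nonneg (hg : ∀ t, g t ∈ Icc 0 1) (s : ℝ) : 0 ≤ innerInt g s :=
  setIntegral_nonneg measurableSet_Iic fun t _ => weight_source_nonneg hg t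

theorem innerInt_le (hm : Measurable g) (hg : ∀ t, g t ∈ Icc 0 1) (s : ℝ) :
    innerInt g s ≤ (1 + radSq s) * weight s := by
  have h := integral_Iic_of_hasDerivAt_of_tendsto' (fun t (_ : t ∈ Iic s) => hasDerivAt_weight' t)
    (integrableOn_weight'' s) tendsto_weight'_atBot
  rw [sub_zero] at h
  rw [← h]
  exact setIntegral_mono (integrableOn_weight_source hm hg s) (integrableOn_weight'' s)
    (weight_source_le hg)

theorem continuous_innerInt (hm : Measurable g) (hg : ∀ t, g t ∈ Icc 0 1) :
    Continuous (innerInt g) :=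
  continuous_integral_Iic (integrableOn_weight_source hm hg)

theorem continuous_innerInt_div (hm : Measurable g) (hg : ∀ t, g t ∈ Icc 0 1) :
    Continuous fun s => innerInt g s / weight s ^ 2 :=
  (continuous_innerInt hm hg).div (by fun_prop) fun s => (pow_pos (weight_pos s) 2).ne'

theorem hasDerivAt_neg_weight_inv (t : ℝ) :
    HasDerivAt (fun t => (weight t)⁻¹) (-((1 + radSq t) / weight t)) t := by
  refine ((hasDerivAt_weight t).inv (weight_pos t).ne').congr_deriv ?_
  have := (weight_pos t).ne'
  field_simp

theorem integrableOn_weight_inv_deriv (t : ℝ) :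
    IntegrableOn (fun s => (1 + radSq s) / weight s) (Ioi t) := by
  have := integrableOn_Ioi_deriv_of_nonpos'
    (fun s (_ : s ∈ Ici t) => hasDerivAt_neg_weight_inv s)
    (fun s _ => neg_nonpos.2 (by have := radSq_pos s; have := weight_pos s; positivity))
    tendsto_weight_inv_atTop
  simpa using this.neg

theorem innerInt_div_nonneg (hg : ∀ t, g t ∈ Icc 0 1) (s : ℝ) :
    0 ≤ innerInt g s / weight s ^ 2 :=
  div_nonneg (innerInt_nonneg hg s) (sq_nonneg _)

theorem innerInt_div_le (hm : Measurable g) (hg : ∀ t, g t ∈ Icc 0 1) (s : ℝ) :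
    innerInt g s / weight s ^ 2 ≤ (1 + radSq s) / weight s := by
  have hw := weight_pos s
  rw [div_le_div_iff₀ (by positivity) hw]
  nlinarith [innerInt_le hm hg s]

theorem integrableOn_innerInt_div (hm : Measurable g) (hg : ∀ t, g t ∈ Icc 0 1) (t : ℝ) :
    IntegrableOn (fun s => innerInt g s / weight s ^ 2) (Ioi t) := by
  refine (integrableOn_weight_inv_deriv t).mono'
    (continuous_innerInt_div hm hg).aestronglyMeasurable (Eventually.of_forall fun s => ?_)
  rw [Real.norm_of_nonneg (innerInt_div_nonneg hg s)]
  exact innerInt_div_le hm hg s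

theorem solOp_mem_Icc (hm : Measurable g) (hg : ∀ t, g t ∈ Icc 0 1) (t : ℝ) :
    solOp g t ∈ Icc 0 1 := by
  have hw := weight_pos t
  refine ⟨mul_nonneg hw.le
    (setIntegral_nonneg measurableSet_Ioi fun s _ => innerInt_div_nonneg hg s), ?_⟩
  have h := integral_Ioi_of_hasDerivAt_of_nonpos'
    (fun s (_ : s ∈ Ici t) => hasDerivAt_neg_weight_inv s)
    (fun s _ => neg_nonpos.2 (by have := radSq_pos s; have := weight_pos s; positivity))
    tendsto_weight_inv_atTop
  rw [integral_neg, zero_sub, neg_inj] at h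
  have h2 := setIntegral_mono (integrableOn_innerInt_div hm hg t)
    (integrableOn_weight_inv_deriv t) (innerInt_div_le hm hg)
  rw [h] at h2
  calc solOp g t ≤ weight t * (weight t)⁻¹ := mul_le_mul_of_nonneg_left h2 hw.le
    _ = 1 := mul_inv_cancel₀ hw.ne'

theorem hasDerivAt_solOp (hm : Measurable g) (hg : ∀ t, g t ∈ Icc 0 1) (t : ℝ) :
    HasDerivAt (solOp g) ((1 + radSq t) * solOp g t - innerInt g t / weight t) t := by
  refine ((hasDerivAt_weight t).mul (hasDerivAt_integral_Ioi (integrableOn_innerInt_div hm hg)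
    (continuous_innerInt_div hm hg) t)).congr_deriv ?_
  have := (weight_pos t).ne'
  unfold solOp
  field_simp
  ring

theorem continuous_solOp (hm : Measurable g) (hg : ∀ t, g t ∈ Icc 0 1) :
    Continuous (solOp g) :=
  continuous_iff_continuousAt.2 fun t => (hasDerivAt_solOp hm hg t).continuousAt

theorem hasDerivAt_innerInt (hc : Continuous g) (hg : ∀ t, g t ∈ Icc 0 1) (t : ℝ) :
    HasDerivAt (innerInt g) (weight t * source t (g t)) t :=
  hasDerivAt_integral_Iic (integrableOn_weight_source hc.measurable hg)
    (by unfold source; fun_prop) t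

theorem innerInt_mono (hm : Measurable g) (hg : ∀ t, g t ∈ Icc 0 1) (hm' : Measurable h)
    (hh : ∀ t, h t ∈ Icc 0 1) (hle : ∀ t, g t ≤ h t) (s : ℝ) : innerInt g s ≤ innerInt h s :=
  setIntegral_mono (integrableOn_weight_source hm hg s) (integrableOn_weight_source hm' hh s)
    fun t => mul_le_mul_of_nonneg_left (source_mono t (hg t).1 (hle t) (hh t).2) (weight_pos t).le

theorem solOp_mono (hm : Measurable g) (hg : ∀ t, g t ∈ Icc 0 1) (hm' : Measurable h)
    (hh : ∀ t, h t ∈ Icc 0 1) (hle : ∀ t, g t ≤ h t) (t : ℝ) : solOp g t ≤ solOp h t :=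
  mul_le_mul_of_nonneg_left (setIntegral_mono (integrableOn_innerInt_div hm hg t)
    (integrableOn_innerInt_div hm' hh t) fun s =>
      div_le_div_of_nonneg_right (innerInt_mono hm hg hm' hh hle s) (sq_nonneg _))
    (weight_pos t).le

/-- Bounded subsolutions of `h'' = h - radSq * (h - h ^ 3)` lying below `g` lie below
`solOp g`. -/
theorem le_solOp {h₁ h₂ : ℝ → ℝ} (hc : Continuous g) (hg : ∀ t, g t ∈ Icc 0 1)
    (hh : ∀ t, h t ∈ Icc 0 1) (hd : ∀ t, HasDerivAt h (h₁ t) t)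
    (hd' : ∀ t, HasDerivAt h₁ (h₂ t) t) (hb : ∀ t, -(1 + radSq t) ≤ h₁ t)
    (hsub : ∀ t, h t - radSq t * (h t - h t ^ 3) ≤ h₂ t) (hle : ∀ t, h t ≤ g t) (t : ℝ) :
    h t ≤ solOp g t := by
  have hm := hc.measurable
  have hw : ∀ s, 0 ≤ h₁ s * weight s - h s * ((1 + radSq s) * weight s) + innerInt g s := by
    have hmono : Monotone fun s =>
        h₁ s * weight s - h s * ((1 + radSq s) * weight s) + innerInt g s := by
      refine monotone_of_hasDerivAt_nonneg (fun s =>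
        (((hd' s).mul (hasDerivAt_weight s)).sub ((hd s).mul (hasDerivAt_weight' s))).add
          (hasDerivAt_innerInt hc hg s)) fun s => ?_
      have h1 := source_mono s (hh s).1 (hle s) (hg s).2
      have h2 : 0 ≤ h₂ s - (1 + 4 * radSq s + radSq s ^ 2) * h s + source s (g s) := by
        have := hsub s
        unfold source at *
        linarith
      have := mul_nonneg (weight_pos s).le h2
      simp only [Pi.zero_apply]
      linarith
    have hlim : Tendsto (fun s => -2 * ((1 + radSq s) * weight s)) atBot (𝓝 0) := by
      simpa using tendsto_weight'_atBot.const_mul (-2)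
    intro s
    refine le_of_tendsto hlim ?_
    filter_upwards [eventually_le_atBot s] with u hu
    refine le_trans ?_ (hmono hu)
    have h1 := mul_le_mul_of_nonneg_right (hb u) (weight_pos u).le
    have h2 := mul_le_mul_of_nonneg_right (hh u).2
      (mul_nonneg (add_pos one_pos (radSq_pos u)).le (weight_pos u).le)
    have h3 := innerInt_nonneg hg u
    dsimp only
    linarith
  have hmono : Monotone fun s =>
      h s * (weight s)⁻¹ - ∫ σ in Ioi s, innerInt g σ / weight σ ^ 2 := by
    refine monotone_of_hasDerivAt_nonneg (fun s =>
      ((hd s).mul (hasDerivAt_neg_weight_inv s)).sub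
        (hasDerivAt_integral_Ioi (integrableOn_innerInt_div hm hg)
          (continuous_innerInt_div hm hg) s)) fun s => ?_
    have h1 := (weight_pos s).ne'
    have h2 := div_nonneg (hw s) (sq_nonneg (weight s))
    simp only [Pi.zero_apply]
    refine h2.trans_eq ?_
    field_simp
    ring
  have hlim : Tendsto (fun s => (weight s)⁻¹) atTop (𝓝 0) := tendsto_weight_inv_atTop
  have hle0 : h t * (weight t)⁻¹ - ∫ σ in Ioi t, innerInt g σ / weight σ ^ 2 ≤ 0 := by
    refine ge_of_tendsto hlim ?_
    filter_upwards [eventually_ge_atTop t] with u hu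
    refine (hmono hu).trans ?_
    have h1 : 0 ≤ ∫ σ in Ioi u, innerInt g σ / weight σ ^ 2 :=
      setIntegral_nonneg measurableSet_Ioi fun s _ => innerInt_div_nonneg hg s
    have h2 := mul_le_mul_of_nonneg_right (hh u).2 (inv_pos.2 (weight_pos u)).le
    dsimp only
    linarith
  have h3 := mul_le_mul_of_nonneg_left (sub_nonpos.1 hle0) (weight_pos t).le
  have h4 := (weight_pos t).ne'
  calc h t = weight t * (h t * (weight t)⁻¹) := by field_simp
    _ ≤ solOp g t := h3

/-- The decreasing iterates of the solution operator, starting from the supersolution `1`. -/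
noncomputable def iter (n : ℕ) : ℝ → ℝ := solOp^[n] fun _ => 1

theorem iter_succ (n : ℕ) : iter (n + 1) = solOp (iter n) := Function.iterate_succ_apply' _ _ _

theorem continuous_iter_and_mem (n : ℕ) : Continuous (iter n) ∧ ∀ t, iter n t ∈ Icc 0 1 := by
  induction n with
  | zero => exact ⟨continuous_const, fun t => ⟨zero_le_one, le_rfl⟩⟩
  | succ n ih =>
    rw [iter_succ]
    exact ⟨continuous_solOp ih.1.measurable ih.2, solOp_mem_Icc ih.1.measurable ih.2⟩

theorem continuous_iter (n : ℕ) : Continuous (iter n) := (continuous_iter_and_mem n).1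

theorem iter_mem_Icc (n : ℕ) (t : ℝ) : iter n t ∈ Icc 0 1 := (continuous_iter_and_mem n).2 t

theorem iter_succ_le (n : ℕ) (t : ℝ) : iter (n + 1) t ≤ iter n t := by
  induction n generalizing t with
  | zero => exact (iter_mem_Icc 1 t).2
  | succ n ih =>
    rw [iter_succ (n + 1)]
    conv_rhs => rw [iter_succ n]
    exact solOp_mono (continuous_iter _).measurable (iter_mem_Icc _)
      (continuous_iter _).measurable (iter_mem_Icc _) ih t

/-- The vortex profile in the logarithmic variable. -/
noncomputable def logProfile (t : ℝ) : ℝ := ⨅ n, iter n t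

theorem bddBelow_iter (t : ℝ) : BddBelow (range fun n => iter n t) :=
  ⟨0, by rintro _ ⟨n, rfl⟩; exact (iter_mem_Icc n t).1⟩

theorem tendsto_iter (t : ℝ) : Tendsto (fun n => iter n t) atTop (𝓝 (logProfile t)) :=
  tendsto_atTop_ciInf (antitone_nat_of_succ_le fun n => iter_succ_le n t) (bddBelow_iter t)

theorem logProfile_mem_Icc (t : ℝ) : logProfile t ∈ Icc 0 1 :=
  isClosed_Icc.mem_of_tendsto (tendsto_iter t) (Eventually.of_forall fun n => iter_mem_Icc n t)

theorem measurable_logProfile : Measurable logProfile :=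
  measurable_of_tendsto_metrizable (fun n => (continuous_iter n).measurable)
    (tendsto_pi_nhds.2 tendsto_iter)

theorem tendsto_innerInt_iter (s : ℝ) :
    Tendsto (fun n => innerInt (iter n) s) atTop (𝓝 (innerInt logProfile s)) := by
  refine tendsto_integral_of_dominated_convergence _
    (fun n => (measurable_weight_source (continuous_iter n).measurable).aestronglyMeasurable)
    (integrableOn_weight'' s) (fun n => Eventually.of_forall fun t => ?_)
    (Eventually.of_forall fun t => ?_)
  · rw [Real.norm_of_nonneg (weight_source_nonneg (iter_mem_Icc n) t)]
    exact weight_source_le (iter_mem_Icc n) t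
  · have hc : Continuous fun y => weight t * source t y := by unfold source; fun_prop
    exact (hc.tendsto _).comp (tendsto_iter t)

theorem tendsto_solOp_iter (t : ℝ) :
    Tendsto (fun n => solOp (iter n) t) atTop (𝓝 (solOp logProfile t)) := by
  refine Tendsto.const_mul _ (tendsto_integral_of_dominated_convergence _
    (fun n => (continuous_innerInt_div (continuous_iter n).measurable
      (iter_mem_Icc n)).aestronglyMeasurable)
    (integrableOn_weight_inv_deriv t) (fun n => Eventually.of_forall fun s => ?_)
    (Eventually.of_forall fun s => (tendsto_innerInt_iter s).div_const _))
  rw [Real.norm_of_nonneg (innerInt_div_nonneg (iter_mem_Icc n) s)]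
  exact innerInt_div_le (continuous_iter n).measurable (iter_mem_Icc n) s

theorem solOp_logProfile : solOp logProfile = logProfile := by
  ext t
  refine tendsto_nhds_unique (tendsto_solOp_iter t) ?_
  simp_rw [← iter_succ]
  exact (tendsto_iter t).comp (tendsto_add_atTop_nat 1)

theorem continuous_logProfile : Continuous logProfile := by
  rw [← solOp_logProfile]
  exact continuous_solOp measurable_logProfile logProfile_mem_Icc

/-- The derivative of `logProfile`. -/
noncomputable def logProfile' (t : ℝ) : ℝ :=
  (1 + radSq t) * logProfile t - innerInt logProfile t / weight t

theorem hasDerivAt_logProfile (t : ℝ) : HasDerivAt logProfile (logProfile' t) t := by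
  have := hasDerivAt_solOp measurable_logProfile logProfile_mem_Icc t
  rwa [solOp_logProfile] at this

theorem hasDerivAt_logProfile' (t : ℝ) :
    HasDerivAt logProfile' (logProfile t - radSq t * (logProfile t - logProfile t ^ 3)) t := by
  have hw := (weight_pos t).ne'
  refine ((((hasDerivAt_radSq t).const_add 1).mul (hasDerivAt_logProfile t)).sub
    ((hasDerivAt_innerInt continuous_logProfile logProfile_mem_Icc t).div
      (hasDerivAt_weight t) hw)).congr_deriv ?_
  unfold logProfile' source
  field_simp
  ring

theorem neg_le_logProfile' (t : ℝ) : -(1 + radSq t) ≤ logProfile' t := by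
  have h1 : innerInt logProfile t / weight t ≤ 1 + radSq t :=
    (div_le_iff₀ (weight_pos t)).2 (innerInt_le measurable_logProfile logProfile_mem_Icc t)
  have h2 := mul_nonneg (add_pos one_pos (radSq_pos t)).le (logProfile_mem_Icc t).1
  unfold logProfile'
  linarith

/-- `logProfile` is above every bounded subsolution. -/
theorem le_logProfile {h₁ h₂ : ℝ → ℝ}
    (hh : ∀ t, h t ∈ Icc 0 1) (hd : ∀ t, HasDerivAt h (h₁ t) t)
    (hd' : ∀ t, HasDerivAt h₁ (h₂ t) t) (hb : ∀ t, -(1 + radSq t) ≤ h₁ t)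
    (hsub : ∀ t, h t - radSq t * (h t - h t ^ 3) ≤ h₂ t) (t : ℝ) : h t ≤ logProfile t := by
  refine le_ciInf fun n => ?_
  induction n generalizing t with
  | zero => exact (hh t).2
  | succ n ih =>
    rw [iter_succ]
    exact le_solOp (continuous_iter n) (iter_mem_Icc n) hh hd hd' hb hsub ih t

theorem monotone_logProfile : Monotone logProfile := by
  intro a b hab
  have hs : 0 ≤ b - a := sub_nonneg.2 hab
  have := le_logProfile (h := fun t => logProfile (t - (b - a))) (fun t => logProfile_mem_Icc _)
    (fun t => (hasDerivAt_logProfile _).comp_sub_const t (b - a))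
    (fun t => (hasDerivAt_logProfile' _).comp_sub_const t (b - a))
    (fun t => ?_) (fun t => ?_) b
  · simpa using this
  · have := neg_le_logProfile' (t - (b - a))
    have := radSq_mono (sub_le_self t hs)
    linarith
  · have h1 := radSq_mono (sub_le_self t hs)
    have h2 : 0 ≤ logProfile (t - (b - a)) - logProfile (t - (b - a)) ^ 3 := by
      obtain ⟨h3, h4⟩ := logProfile_mem_Icc (t - (b - a))
      nlinarith [mul_nonneg h3 (sub_nonneg.2 h4), mul_nonneg (mul_nonneg h3 h3) (sub_nonneg.2 h4)]
    have := mul_le_mul_of_nonneg_right h1 h2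
    linarith

/-- The explicit subsolution `r / √(r ^ 2 + 4)`. -/
theorem radSq_div_le_logProfile_sq (t : ℝ) : radSq t / (radSq t + 4) ≤ logProfile t ^ 2 := by
  have hp : ∀ s, 0 < radSq s / (radSq s + 4) := fun s => by
    have := radSq_pos s; positivity
  have hq : ∀ s, HasDerivAt (fun s => radSq s / (radSq s + 4))
      (8 * radSq s / (radSq s + 4) ^ 2) s := fun s => by
    have := radSq_pos s
    refine ((hasDerivAt_radSq s).div ((hasDerivAt_radSq s).add_const 4)
      (by positivity)).congr_deriv ?_
    field_simp
    ring
  have hd : ∀ s, HasDerivAt (fun s => √(radSq s / (radSq s + 4)))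
      (√(radSq s / (radSq s + 4)) * (4 / (radSq s + 4))) s := fun s => by
    have h0 := radSq_pos s
    have h1 := Real.sqrt_pos.2 (hp s)
    have h2 := Real.sq_sqrt (hp s).le
    refine ((hq s).sqrt (hp s).ne').congr_deriv ?_
    rw [div_eq_iff (by positivity)]
    have h3 : 8 * radSq s / (radSq s + 4) ^ 2 = 8 / (radSq s + 4) * (radSq s / (radSq s + 4)) := by
      field_simp
    linear_combination h3 - 8 / (radSq s + 4) * h2
  have hd' : ∀ s, HasDerivAt (fun s => √(radSq s / (radSq s + 4)) * (4 / (radSq s + 4)))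
      (√(radSq s / (radSq s + 4)) * ((16 - 8 * radSq s) / (radSq s + 4) ^ 2)) s := fun s => by
    have h0 := radSq_pos s
    refine ((hd s).mul ((hasDerivAt_const s (4 : ℝ)).div ((hasDerivAt_radSq s).add_const 4)
      (by positivity))).congr_deriv ?_
    simp only [Pi.div_apply]
    field_simp
    ring
  have := le_logProfile (fun s => ⟨Real.sqrt_nonneg _, ?_⟩) hd hd' (fun s => ?_) (fun s => ?_) t
  · exact Real.sqrt_le_left (logProfile_mem_Icc t).1 |>.1 this
  · have h0 := radSq_pos s
    rw [Real.sqrt_le_one, div_le_one (by positivity)]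
    linarith
  · have h0 := radSq_pos s
    have : 0 ≤ √(radSq s / (radSq s + 4)) * (4 / (radSq s + 4)) := by positivity
    linarith
  · have h0 := radSq_pos s
    have h1 := Real.sqrt_nonneg (radSq s / (radSq s + 4))
    have h2 := Real.sq_sqrt (hp s).le
    have h3 : 1 - radSq s * (1 - radSq s / (radSq s + 4)) ≤
        (16 - 8 * radSq s) / (radSq s + 4) ^ 2 := by
      rw [le_div_iff₀ (by positivity)]
      field_simp
      nlinarith [pow_pos h0 2, pow_pos h0 3]
    have h4 := mul_le_mul_of_nonneg_left h3 h1
    calc _ = √(radSq s / (radSq s + 4)) * (1 - radSq s * (1 - √(radSq s / (radSq s + 4)) ^ 2)) := by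
          ring
      _ ≤ _ := by rw [h2]; exact h4

theorem logProfile_pos (t : ℝ) : 0 < logProfile t := by
  have h0 := radSq_pos t
  have h1 : 0 < radSq t / (radSq t + 4) := by positivity
  exact (sq_pos_iff.1 (h1.trans_le (radSq_div_le_logProfile_sq t))).lt_of_le'
    (logProfile_mem_Icc t).1

theorem strictMono_logProfile : StrictMono logProfile := by
  intro a b hab
  refine (monotone_logProfile hab.le).lt_of_ne fun heq => ?_
  have hconst : ∀ t ∈ Icc a b, logProfile t = logProfile a := fun t ht =>
    le_antisymm ((monotone_logProfile ht.2).trans heq.ge) (monotone_logProfile ht.1)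
  have h1 : ∀ t ∈ Ioo a b, logProfile' t = 0 := fun t ht => by
    have : logProfile =ᶠ[𝓝 t] fun _ => logProfile a := by
      filter_upwards [Ioo_mem_nhds ht.1 ht.2] with s hs using hconst s (Ioo_subset_Icc_self hs)
    exact (hasDerivAt_logProfile t).unique ((hasDerivAt_const t _).congr_of_eventuallyEq this)
  have h2 : ∀ t ∈ Ioo a b,
      logProfile a - radSq t * (logProfile a - logProfile a ^ 3) = 0 := fun t ht => by
    have : logProfile' =ᶠ[𝓝 t] fun _ => 0 := by
      filter_upwards [Ioo_mem_nhds ht.1 ht.2] with s hs using h1 s hs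
    rw [← hconst t (Ioo_subset_Icc_self ht)]
    exact (hasDerivAt_logProfile' t).unique ((hasDerivAt_const t _).congr_of_eventuallyEq this)
  obtain ⟨c, hac, hcb⟩ := exists_between hab
  obtain ⟨d, hcd, hdb⟩ := exists_between hcb
  have hc := h2 c ⟨hac, hcb⟩
  have hd := h2 d ⟨hac.trans hcd, hdb⟩
  have hlt : radSq c < radSq d := Real.exp_lt_exp.2 (by linarith)
  have h3 : (radSq d - radSq c) * (logProfile a - logProfile a ^ 3) = 0 := by linarith
  rcases mul_eq_zero.1 h3 with h | h
  · linarith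
  · rw [h] at hc
    linarith [logProfile_pos a]

theorem logProfile_lt_one (t : ℝ) : logProfile t < 1 :=
  (strictMono_logProfile (lt_add_one t)).trans_le (logProfile_mem_Icc _).2

theorem radSq_log {r : ℝ} (hr : 0 < r) : radSq (Real.log r) = r ^ 2 := by
  rw [radSq, two_mul, Real.exp_add, Real.exp_log hr, sq]

/-- The degree-one radial vortex profile. -/
noncomputable def profile (r : ℝ) : ℝ := if 0 < r then logProfile (Real.log r) else 0

theorem profile_of_pos {r : ℝ} (hr : 0 < r) : profile r = logProfile (Real.log r) := if_pos hr

theorem hasDerivAt_profile {r : ℝ} (hr : 0 < r) :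
    HasDerivAt profile (logProfile' (Real.log r) / r) r := by
  have h := (hasDerivAt_logProfile (Real.log r)).comp r (Real.hasDerivAt_log hr.ne')
  rw [← div_eq_mul_inv] at h
  refine h.congr_of_eventuallyEq ?_
  filter_upwards [lt_mem_nhds hr] with s hs using profile_of_pos hs

theorem hasDerivAt_deriv_profile {r : ℝ} (hr : 0 < r) :
    HasDerivAt (deriv profile)
      (profile r / r ^ 2 - profile r * (1 - profile r ^ 2) - deriv profile r / r) r := by
  have h := ((hasDerivAt_logProfile' (Real.log r)).comp r (Real.hasDerivAt_log hr.ne')).div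
    (hasDerivAt_id r) hr.ne'
  refine (h.congr_of_eventuallyEq ?_).congr_deriv ?_
  · filter_upwards [lt_mem_nhds hr] with s hs using (hasDerivAt_profile hs).deriv
  · rw [radSq_log hr, (hasDerivAt_profile hr).deriv, profile_of_pos hr]
    simp only [id, Function.comp_apply]
    field_simp

theorem contDiffOn_profile : ContDiffOn ℝ 2 profile (Ioi 0) := by
  have hd : DifferentiableOn ℝ (deriv profile) (Ioi 0) := fun r hr =>
    (hasDerivAt_deriv_profile hr).differentiableAt.differentiableWithinAt
  have h0 : DifferentiableOn ℝ profile (Ioi 0) := fun r hr =>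
    (hasDerivAt_profile hr).differentiableAt.differentiableWithinAt
  rw [show (2 : WithTop ℕ∞) = 1 + 1 by norm_num, contDiffOn_succ_iff_deriv_of_isOpen isOpen_Ioi]
  refine ⟨h0, by simp, ?_⟩
  rw [show (1 : WithTop ℕ∞) = 0 + 1 by norm_num, contDiffOn_succ_iff_deriv_of_isOpen isOpen_Ioi]
  refine ⟨hd, by simp, contDiffOn_zero.2 ?_⟩
  have hne : ∀ r ∈ Ioi (0 : ℝ), r ≠ 0 := fun r hr => (mem_Ioi.1 hr).ne'
  have hc : ContinuousOn (fun r =>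
      profile r / r ^ 2 - profile r * (1 - profile r ^ 2) - deriv profile r / r) (Ioi 0) :=
    ((h0.continuousOn.div (continuousOn_id.pow 2) fun r hr => pow_ne_zero 2 (hne r hr)).sub
      (h0.continuousOn.mul (continuousOn_const.sub (h0.continuousOn.pow 2)))).sub
      (hd.continuousOn.div continuousOn_id hne)
  exact hc.congr fun r hr => (hasDerivAt_deriv_profile hr).deriv

theorem one_sub_profile_sq_le {r : ℝ} (hr : 0 < r) : 1 - profile r ^ 2 ≤ 4 / r ^ 2 := by
  have h := radSq_div_le_logProfile_sq (Real.log r)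
  rw [radSq_log hr] at h
  rw [profile_of_pos hr]
  have h1 : 1 - r ^ 2 / (r ^ 2 + 4) = 4 / (r ^ 2 + 4) := by field_simp; ring
  have h2 : 4 / (r ^ 2 + 4) ≤ 4 / r ^ 2 := by gcongr; linarith
  linarith

theorem profile_nonneg_and_lt_one (r : ℝ) : 0 ≤ profile r ∧ profile r < 1 := by
  unfold profile
  split_ifs
  exacts [⟨(logProfile_pos _).le, logProfile_lt_one _⟩, ⟨le_rfl, one_pos⟩]

theorem strictMonoOn_profile : StrictMonoOn profile (Ici 0) := by
  intro a ha b _ hab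
  have hb := lt_of_le_of_lt ha hab
  rw [profile_of_pos hb]
  unfold profile
  split_ifs with h
  exacts [strictMono_logProfile (Real.log_lt_log h hab), logProfile_pos _]

theorem tendsto_profile : Tendsto profile atTop (𝓝 1) := by
  have hlim : Tendsto (fun r : ℝ => 1 - 4 / r ^ 2) atTop (𝓝 1) := by
    simpa using (tendsto_const_nhds (x := (4 : ℝ)).div_atTop
      (tendsto_pow_atTop (α := ℝ) two_ne_zero)).const_sub 1
  refine tendsto_of_tendsto_of_tendsto_of_le_of_le' hlim tendsto_const_nhds ?_
    (Eventually.of_forall fun r => (profile_nonneg_and_lt_one r).2.le)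
  filter_upwards [eventually_gt_atTop 0] with r hr
  have := one_sub_profile_sq_le hr
  obtain ⟨h0, h1⟩ := profile_nonneg_and_lt_one r
  nlinarith

end GinzburgLandau

/-- the radial degree-one Ginzburg–Landau profile. -/
theorem stmt11 :
    ∃ f : ℝ → ℝ,
      ContDiffOn ℝ 2 f (Set.Ioi 0) ∧
      f 0 = 0 ∧
      (∀ r, 0 ≤ r → 0 ≤ f r ∧ f r < 1) ∧
      StrictMonoOn f (Set.Ici 0) ∧
      (∀ r : ℝ, 0 < r →
        -(deriv (deriv f) r) - deriv f r / r + f r / r ^ 2 = f r * (1 - (f r) ^ 2)) ∧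
      Tendsto f atTop (nhds 1) ∧
      ∃ C : ℝ, ∀ r : ℝ, 1 ≤ r → 1 - (f r) ^ 2 ≤ C / r ^ 2 := by
  open GinzburgLandau in
  refine ⟨profile, contDiffOn_profile, if_neg (lt_irrefl 0),
    fun r _ => profile_nonneg_and_lt_one r, strictMonoOn_profile, fun r hr => ?_,
    tendsto_profile, 4, fun r hr => one_sub_profile_sq_le (one_pos.trans_le hr)⟩
  rw [(hasDerivAt_deriv_profile hr).deriv]
  ring
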